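/- For all natural numbers n, the Fishburn number ξ(7n+6) is divisible by 7. -/

import Mathlib

open Polynomial Finset

/-- The Fishburn numbers: ξ(n) is the coefficient of q^n in
∑_{j=0}^{n} ∏_{i=1}^{j} (1 - (1-q)^i). -/
noncomputable def fishburn (n : ℕ) : ℤ :=
  (∑ j ∈ Finset.range (n + 1), ∏ i ∈ Finset.range j, (1 - (1 - X) ^ (i + 1)) : Polynomial ℤ).coeff n

section PartialSums

variable {R : Type*} [CommRing R]

/-- The `q`-Pochhammer symbol `(x; q)_n`. -/
def qPoch (q x : R) (n : ℕ) : R := ∏ i ∈ range n, (1 - x * q ^ i)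

theorem qPoch_succ (q x : R) (n : ℕ) :
    qPoch q x (n + 1) = qPoch q x n * (1 - x * q ^ n) :=
  prod_range_succ _ n

theorem qPoch_succ_left (q x : R) (n : ℕ) :
    qPoch q x (n + 1) = (1 - x) * qPoch q (x * q) n := by
  simp only [qPoch, prod_range_succ', pow_zero, mul_one, pow_succ']
  rw [mul_comm]
  simp only [mul_assoc]

/-- The partial sums of Zagier's series `∑ (x; q)_{n+1} x ^ n`. -/
def zagierSum (q x : R) (N : ℕ) : R := ∑ n ∈ range N, qPoch q x (n + 1) * x ^ n

theorem zagierSum_succ (q x : R) (N : ℕ) :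
    zagierSum q x (N + 1) = zagierSum q x N + qPoch q x (N + 1) * x ^ N :=
  sum_range_succ _ N

theorem zagierSum_eq_mul (q x : R) (N : ℕ) :
    zagierSum q x N = (1 - x) * ∑ n ∈ range N, qPoch q (x * q) n * x ^ n := by
  simp only [zagierSum, qPoch_succ_left, mul_sum, mul_assoc]

/-- The functional equation of Zagier's series, for partial sums. -/
theorem zagierSum_add_two (q x : R) (N : ℕ) :
    zagierSum q x (N + 2) = 1 - q * x ^ 2 - q ^ 2 * x ^ 3 * zagierSum q (x * q) N
      - qPoch q (x * q) (N + 1) * x ^ (N + 2) := by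
  induction N with
  | zero => simp [zagierSum, qPoch, sum_range_succ, prod_range_succ]; ring
  | succ N ih =>
    rw [zagierSum_succ q x (N + 2), ih, zagierSum_succ q (x * q), qPoch_succ_left q x,
      qPoch_succ q (x * q) (N + 1)]
    ring

theorem one_sub_pow_dvd_qPoch (q : R) (j n : ℕ) : (1 - q) ^ n ∣ qPoch q (q ^ j) n := by
  have h : ∏ _i ∈ range n, (1 - q) ∣ qPoch q (q ^ j) n :=
    prod_dvd_prod_of_dvd _ _ fun i _ => by
      simpa [← pow_add] using sub_dvd_pow_sub_pow 1 q (j + i)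
  simpa using h

theorem one_sub_pow_dvd_zagierSum_sub (q : R) (j K : ℕ) :
    (1 - q) ^ K ∣ zagierSum q (q ^ j) K -
      (1 - q ^ (2 * j + 1) - q ^ (3 * j + 2) * zagierSum q (q ^ (j + 1)) K) := by
  have h := zagierSum_add_two q (q ^ j) K
  rw [zagierSum_succ, zagierSum_succ, ← pow_succ] at h
  have e : zagierSum q (q ^ j) K -
      (1 - q ^ (2 * j + 1) - q ^ (3 * j + 2) * zagierSum q (q ^ (j + 1)) K) =
      -(qPoch q (q ^ (j + 1)) (K + 1) * (q ^ j) ^ (K + 2)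
        + qPoch q (q ^ j) (K + 1) * (q ^ j) ^ K
        + qPoch q (q ^ j) (K + 2) * (q ^ j) ^ (K + 1)) := by
    linear_combination h
  have hd (i m : ℕ) (hm : K ≤ m) : (1 - q) ^ K ∣ qPoch q (q ^ i) m :=
    (pow_dvd_pow _ hm).trans (one_sub_pow_dvd_qPoch q i m)
  rw [e, dvd_neg]
  exact dvd_add (dvd_add ((hd _ _ (by lia)).mul_right _) ((hd _ _ (by lia)).mul_right _))
    ((hd _ _ (by lia)).mul_right _)

/-- The partial sums of the pentagonal number series, two terms at a time. -/
def pentagonalSum (q : R) (j : ℕ) : R :=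
  ∑ k ∈ range j, (-1) ^ k * (q ^ (k * (3 * k + 1) / 2) - q ^ ((k + 1) * (3 * k + 2) / 2))

theorem one_sub_pow_dvd_pentagonalSum_add (q : R) (j K : ℕ) :
    (1 - q) ^ K ∣
      pentagonalSum q j + (-1) ^ j * q ^ (j * (3 * j + 1) / 2) * zagierSum q (q ^ j) K := by
  induction j with
  | zero => simp [pentagonalSum, zagierSum_eq_mul]
  | succ j ih =>
    have e₁ : (j + 1) * (3 * j + 2) / 2 = j * (3 * j + 1) / 2 + (2 * j + 1) := by
      rw [← Nat.add_mul_div_right _ _ two_pos]; ring_nf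
    have e₂ : (j + 1) * (3 * (j + 1) + 1) / 2 = j * (3 * j + 1) / 2 + (3 * j + 2) := by
      rw [← Nat.add_mul_div_right _ _ two_pos]; ring_nf
    have h := dvd_sub ih ((one_sub_pow_dvd_zagierSum_sub q j K).mul_left
      ((-1) ^ j * q ^ (j * (3 * j + 1) / 2)))
    convert h using 1
    rw [pentagonalSum, sum_range_succ, ← pentagonalSum, e₁, e₂]
    ring

theorem dvd_qPoch_sub_qPoch {d x y : R} (q : R) (h : d ∣ x - y) (n : ℕ) :
    d ∣ qPoch q x n - qPoch q y n := by
  induction n with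
  | zero => simp [qPoch]
  | succ n ih =>
    rw [qPoch_succ, qPoch_succ]
    convert dvd_sub (ih.mul_right (1 - x * q ^ n)) (h.mul_left (qPoch q y n * q ^ n)) using 1
    ring

theorem dvd_sum_qPoch_sub {d x : R} (q : R) (h : d ∣ x - 1) (N : ℕ) :
    d ∣ (∑ n ∈ range N, qPoch q (x * q) n * x ^ n) - ∑ n ∈ range N, qPoch q q n := by
  rw [← sum_sub_distrib]
  refine dvd_sum fun n _ => ?_
  have h₁ : d ∣ qPoch q (x * q) n - qPoch q q n :=
    dvd_qPoch_sub_qPoch q (by convert h.mul_right q using 1; ring) n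
  have h₂ : d ∣ x ^ n - 1 := by simpa using h.trans (sub_dvd_pow_sub_pow x 1 n)
  convert dvd_add (h₁.mul_right (x ^ n)) (h₂.mul_left (qPoch q q n)) using 1
  ring

end PartialSums

theorem Nat.mod_seven_lt_six_of_two_mul_eq_mul {e k : ℕ} (h : 2 * e = k * (3 * k + 1)) :
    e % 7 < 6 := by
  have key : ∀ e k : ZMod 7, 2 * e = k * (3 * k + 1) → e.val < 6 := by decide
  have := key e k (by exact_mod_cast congrArg (Nat.cast : ℕ → ZMod 7) h)
  rwa [ZMod.val_natCast] at this

theorem Nat.mod_seven_lt_six_of_two_mul_eq_succ_mul {e k : ℕ} (h : 2 * e = (k + 1) * (3 * k + 2)) :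
    e % 7 < 6 := by
  have key : ∀ e k : ZMod 7, 2 * e = (k + 1) * (3 * k + 2) → e.val < 6 := by decide
  have := key e k (by exact_mod_cast congrArg (Nat.cast : ℕ → ZMod 7) h)
  rwa [ZMod.val_natCast] at this

theorem coeff_one_sub_X_pow_of_mod_seven {e : ℕ} (he : e % 7 < 6) (m : ℕ) :
    ((1 - X : (ZMod 7)[X]) ^ e).coeff (7 * m + 6) = 0 := by
  have : Fact (Nat.Prime 7) := ⟨by norm_num⟩
  have h₀ : (e.choose (7 * m + 6) : ZMod 7) = 0 := by
    have h := Choose.choose_modEq_choose_mod_mul_choose_div_nat (p := 7) (n := e) (k := 7 * m + 6)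
    rw [show (7 * m + 6) % 7 = 6 by lia, Nat.choose_eq_zero_of_lt he, zero_mul] at h
    exact_mod_cast (ZMod.natCast_eq_natCast_iff _ _ 7).2 h
  have h₁ : (1 - X : (ZMod 7)[X]) = C (-1) * (X + C (-1)) := by simp; ring
  rw [h₁, mul_pow, ← C_pow, coeff_C_mul, coeff_X_add_C_pow, h₀, mul_zero, mul_zero]

theorem coeff_pentagonalSum_mod_seven (j m : ℕ) :
    (pentagonalSum (1 - X : (ZMod 7)[X]) j).coeff (7 * m + 6) = 0 := by
  rw [pentagonalSum, finsetSum_coeff]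
  refine sum_eq_zero fun k _ => ?_
  have h₁ : 2 * (k * (3 * k + 1) / 2) = k * (3 * k + 1) :=
    Nat.two_mul_div_two_of_even (by grind)
  have h₂ : 2 * ((k + 1) * (3 * k + 2) / 2) = (k + 1) * (3 * k + 2) :=
    Nat.two_mul_div_two_of_even (by grind)
  have h : ((1 - X : (ZMod 7)[X]) ^ (k * (3 * k + 1) / 2)
      - (1 - X) ^ ((k + 1) * (3 * k + 2) / 2)).coeff (7 * m + 6) = 0 := by
    rw [coeff_sub, coeff_one_sub_X_pow_of_mod_seven (Nat.mod_seven_lt_six_of_two_mul_eq_mul h₁),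
      coeff_one_sub_X_pow_of_mod_seven (Nat.mod_seven_lt_six_of_two_mul_eq_succ_mul h₂), sub_zero]
  rcases neg_one_pow_eq_or (ZMod 7)[X] k with hk | hk
  · rw [hk, one_mul, h]
  · rw [hk, neg_one_mul, coeff_neg, h, neg_zero]

theorem X_pow_dvd_pentagonalSum_sub (s : ℕ) :
    (X : (ZMod 7)[X]) ^ (2 * 7 ^ s) ∣ pentagonalSum (1 - X) (7 ^ s) -
      X ^ 7 ^ s * ∑ n ∈ range (2 * 7 ^ s), qPoch (1 - X) (1 - X) n := by
  have : Fact (Nat.Prime 7) := ⟨by norm_num⟩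
  have hq : (1 - X : (ZMod 7)[X]) ^ 7 ^ s = 1 - X ^ 7 ^ s := by
    rw [sub_pow_char_pow, one_pow]
  have hodd : Odd (7 ^ s) := Odd.pow (by decide)
  have h := one_sub_pow_dvd_pentagonalSum_add (1 - X : (ZMod 7)[X]) (7 ^ s) (2 * 7 ^ s)
  rw [Nat.mul_div_assoc _ (by grind), pow_mul (1 - X), hodd.neg_one_pow, hq, zagierSum_eq_mul,
    sub_sub_cancel, sub_sub_cancel] at h
  have hT := dvd_sum_qPoch_sub (1 - X : (ZMod 7)[X]) (d := X ^ 7 ^ s) (x := 1 - X ^ 7 ^ s)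
    ⟨-1, by ring⟩ (2 * 7 ^ s)
  have hc : (X : (ZMod 7)[X]) ^ 7 ^ s ∣ (1 - X ^ 7 ^ s) ^ ((3 * 7 ^ s + 1) / 2) - 1 := by
    have := sub_dvd_pow_sub_pow (1 - X ^ 7 ^ s : (ZMod 7)[X]) 1 ((3 * 7 ^ s + 1) / 2)
    rw [one_pow] at this
    exact Dvd.dvd.trans ⟨-1, by ring⟩ this
  have hX : (X : (ZMod 7)[X]) ^ (2 * 7 ^ s) = X ^ 7 ^ s * X ^ 7 ^ s := by rw [two_mul, pow_add]
  rw [hX] at h ⊢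
  generalize (∑ n ∈ range (2 * 7 ^ s), qPoch (1 - X : (ZMod 7)[X])
    ((1 - X ^ 7 ^ s) * (1 - X)) n * (1 - X ^ 7 ^ s) ^ n) = T at *
  generalize (∑ n ∈ range (2 * 7 ^ s), qPoch (1 - X : (ZMod 7)[X]) (1 - X) n) = F at *
  convert dvd_add (dvd_add h (mul_dvd_mul_left (X ^ 7 ^ s) (hc.mul_right T)))
    (mul_dvd_mul_left (X ^ 7 ^ s) hT) using 1
  ring

theorem X_pow_dvd_qPoch_one_sub_X {R : Type*} [CommRing R] (n : ℕ) :
    (X : R[X]) ^ n ∣ qPoch (1 - X) (1 - X) n := by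
  have h := one_sub_pow_dvd_qPoch (1 - X : R[X]) 1 n
  rwa [pow_one, sub_sub_cancel] at h

theorem fishburn_cast_eq_coeff (R : Type*) [CommRing R] {n N : ℕ} (h : n < N) :
    (fishburn n : R) =
      (∑ j ∈ range N, qPoch (1 - X : R[X]) (1 - X) j).coeff n := by
  have hmap : (fishburn n : R) =
      (∑ j ∈ range (n + 1), qPoch (1 - X : R[X]) (1 - X) j).coeff n := by
    rw [fishburn, ← eq_intCast (Int.castRingHom R), ← coeff_map]
    simp [qPoch, Polynomial.map_sum, Polynomial.map_prod, pow_succ']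
  rw [hmap, finsetSum_coeff, finsetSum_coeff]
  refine sum_subset (range_subset_range.2 h) fun j _ hj => ?_
  exact X_pow_dvd_iff.1 (X_pow_dvd_qPoch_one_sub_X j) n (by simpa using hj)

theorem fishburn_mod7_cong6 : ∀ n : ℕ, (7 : ℤ) ∣ fishburn (7 * n + 6) := by
  intro n
  have hlt : 7 * n + 6 < 7 ^ (n + 2) := by
    induction n with
    | zero => norm_num
    | succ n ih => rw [show n + 1 + 2 = n + 2 + 1 from rfl, pow_succ]; lia
  rw [← Nat.cast_ofNat, ← ZMod.intCast_zmod_eq_zero_iff_dvd,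
    fishburn_cast_eq_coeff (ZMod 7) (N := 2 * 7 ^ (n + 2)) (by lia)]
  have h := X_pow_dvd_iff.1 (X_pow_dvd_pentagonalSum_sub (n + 2)) (7 * n + 6 + 7 ^ (n + 2))
    (by lia)
  rw [coeff_sub, coeff_X_pow_mul, show 7 * n + 6 + 7 ^ (n + 2) = 7 * (n + 7 ^ (n + 1)) + 6 by ring,
    coeff_pentagonalSum_mod_seven, zero_sub, neg_eq_zero] at h
  exact h
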